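/- For every non-negative integer k, the k-th area moment of a random triangle in a unit-area triangle equals (48·k!/((2+k)(3+k))) · Σ_{j=0}^{k+1} j!/((k-j+2)(k+j+3)!). -/

import Mathlib

open MeasureTheory

namespace RandomTriangle

open Set intervalIntegral

theorem hasDerivAt_mul_abs_pow (n : ℕ) {u : ℝ} (hu : u ≠ 0) :
    HasDerivAt (fun u : ℝ => u * |u| ^ n) ((n + 1) * |u| ^ n) u := by
  have h := (hasDerivAt_id u).fun_mul ((hasDerivAt_abs hu).fun_pow n)
  refine h.congr_deriv ?_
  rcases n with _ | n
  · simp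
  · have := self_mul_sign u
    simp only [id, Nat.add_sub_cancel]
    push_cast
    linear_combination ((n : ℝ) + 1) * |u| ^ n * this

theorem hasDerivAt_abs_pow_add_two (n : ℕ) {u : ℝ} (hu : u ≠ 0) :
    HasDerivAt (fun u : ℝ => |u| ^ (n + 2)) ((n + 2) * (u * |u| ^ n)) u := by
  refine ((hasDerivAt_abs hu).fun_pow (n + 2)).congr_deriv ?_
  have := abs_mul_sign u
  simp only [Nat.add_succ_sub_one]
  push_cast
  linear_combination ((n : ℝ) + 2) * |u| ^ n * this

theorem integral_abs_pow (n : ℕ) (a b : ℝ) :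
    ∫ u in a..b, |u| ^ n = (b * |b| ^ n - a * |a| ^ n) / (n + 1) := by
  have h : ∫ u in a..b, ((n : ℝ) + 1) * |u| ^ n = b * |b| ^ n - a * |a| ^ n :=
    integral_eq_of_hasDerivAt_off_countable (fun u => u * |u| ^ n) _ (countable_singleton 0)
      (by fun_prop) (fun u hu => hasDerivAt_mul_abs_pow n hu.2)
      (Continuous.intervalIntegrable (by fun_prop) _ _)
  rw [intervalIntegral.integral_const_mul] at h
  rw [← h]
  field_simp

theorem integral_mul_abs_pow (n : ℕ) (a b : ℝ) :
    ∫ u in a..b, u * |u| ^ n = (|b| ^ (n + 2) - |a| ^ (n + 2)) / (n + 2) := by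
  have h : ∫ u in a..b, ((n : ℝ) + 2) * (u * |u| ^ n) = |b| ^ (n + 2) - |a| ^ (n + 2) :=
    integral_eq_of_hasDerivAt_off_countable (fun u => |u| ^ (n + 2)) _ (countable_singleton 0)
      (by fun_prop) (fun u hu => hasDerivAt_abs_pow_add_two n hu.2)
      (Continuous.intervalIntegrable (by fun_prop) _ _)
  rw [intervalIntegral.integral_const_mul] at h
  rw [← h]
  field_simp

theorem integral_abs_sub_pow (n : ℕ) (L x : ℝ) :
    ∫ y in (0)..L, |x - y| ^ n = (x * |x| ^ n - (x - L) * |x - L| ^ n) / (n + 1) := by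
  rw [intervalIntegral.integral_comp_sub_left (fun u => |u| ^ n) x, integral_abs_pow, sub_zero]

theorem integral_integral_abs_sub_pow (n : ℕ) {L : ℝ} (hL : 0 ≤ L) :
    ∫ x in (0)..L, ∫ y in (0)..L, |x - y| ^ n = 2 * L ^ (n + 2) / ((n + 1) * (n + 2)) := by
  simp_rw [integral_abs_sub_pow]
  rw [intervalIntegral.integral_div, intervalIntegral.integral_sub
      (Continuous.intervalIntegrable (by fun_prop) _ _)
      (Continuous.intervalIntegrable (by fun_prop) _ _),
    intervalIntegral.integral_comp_sub_right (fun u => u * |u| ^ n) L,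
    integral_mul_abs_pow, integral_mul_abs_pow]
  simp only [sub_self, zero_sub, abs_neg, abs_of_nonneg hL, abs_zero]
  field_simp
  ring

/-- The integral of `|ℓ| ^ k` over the standard triangle, where `ℓ` is an affine function vanishing
at `(a, 0)` and `(0, b)`. -/
theorem integral_abs_affine_pow (k : ℕ) {a b : ℝ} (ha : 0 < a) (ha' : a < 1) (hb : 0 < b)
    (hb' : b < 1) (hab : a ≠ b) :
    ∫ x in (0)..1, ∫ y in (0)..(1 - x), |a * y - a * b + b * x| ^ k =
      ((a * b) ^ (k + 1) + ∑ i ∈ Finset.range (k + 1), (1 - a) ^ (k + 2) * b ^ i * a ^ (k - i)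
        + ∑ i ∈ Finset.range (k + 2), a ^ (k + 1) * (1 - a) ^ i * (1 - b) ^ (k + 1 - i)) /
        ((k + 1) * (k + 2)) := by
  have inner (x : ℝ) : ∫ y in (0)..(1 - x), |a * y - a * b + b * x| ^ k =
      a⁻¹ * (((fun u => u * |u| ^ k) ((b - a) * x + a * (1 - b)) -
        (fun u => u * |u| ^ k) (b * x + -(a * b))) / (k + 1)) := by
    have e (y : ℝ) : a * y - a * b + b * x = a * y + (b * x + -(a * b)) := by ring
    simp_rw [e]
    rw [intervalIntegral.integral_comp_mul_add (fun u => |u| ^ k) ha.ne', integral_abs_pow,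
      smul_eq_mul, show a * (1 - x) + (b * x + -(a * b)) = (b - a) * x + a * (1 - b) by ring,
      mul_zero, zero_add]
  simp_rw [inner]
  have hba : b - a ≠ 0 := sub_ne_zero.2 hab.symm
  rw [intervalIntegral.integral_const_mul, intervalIntegral.integral_div,
    intervalIntegral.integral_sub
      (Continuous.intervalIntegrable (by fun_prop) _ _)
      (Continuous.intervalIntegrable (by fun_prop) _ _),
    intervalIntegral.integral_comp_mul_add (fun u => u * |u| ^ k) hba,
    intervalIntegral.integral_comp_mul_add (fun u => u * |u| ^ k) hb.ne',
    integral_mul_abs_pow, integral_mul_abs_pow]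
  have e1 : (b - a) * 1 + a * (1 - b) = b * (1 - a) := by ring
  have e2 : (b - a) * 0 + a * (1 - b) = a * (1 - b) := by ring
  have e3 : b * 1 + -(a * b) = b * (1 - a) := by ring
  have e4 : b * 0 + -(a * b) = -(a * b) := by ring
  rw [e1, e2, e3, e4, abs_neg, abs_of_nonneg (by nlinarith), abs_of_nonneg (by nlinarith),
    abs_of_nonneg (by nlinarith)]
  have g1 := geom_sum₂_mul b a (k + 1)
  have g2 := geom_sum₂_mul (1 - a) (1 - b) (k + 2)
  have h1 : ∑ i ∈ Finset.range (k + 1), (1 - a) ^ (k + 2) * b ^ i * a ^ (k - i) =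
      (1 - a) ^ (k + 2) * ((b ^ (k + 1) - a ^ (k + 1)) / (b - a)) := by
    rw [← g1, mul_div_cancel_right₀ _ hba, Finset.mul_sum]
    refine Finset.sum_congr rfl fun i _ => ?_
    simp [mul_assoc]
  have h2 : ∑ i ∈ Finset.range (k + 2), a ^ (k + 1) * (1 - a) ^ i * (1 - b) ^ (k + 1 - i) =
      a ^ (k + 1) * (((1 - a) ^ (k + 2) - (1 - b) ^ (k + 2)) / (b - a)) := by
    rw [← g2, show 1 - a - (1 - b) = b - a by ring, mul_div_cancel_right₀ _ hba, Finset.mul_sum]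
    refine Finset.sum_congr rfl fun i _ => ?_
    simp [mul_assoc]
  rw [h1, h2]
  simp only [smul_eq_mul, mul_pow, pow_succ]
  field_simp
  ring

theorem integral_pow_mul_one_sub_pow (m n : ℕ) :
    ∫ x in (0 : ℝ)..1, x ^ m * (1 - x) ^ n =
      (m.factorial * n.factorial : ℝ) / (m + n + 1).factorial := by
  induction n generalizing m with
  | zero =>
    simp only [pow_zero, mul_one, integral_pow, Nat.factorial_zero, Nat.cast_one, add_zero,
      Nat.factorial_succ]
    push_cast
    have : (m.factorial : ℝ) ≠ 0 := by positivity
    field_simp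
    simp
  | succ n ih =>
    have h : ∫ x in (0 : ℝ)..1, (((m : ℝ) + 1) * (x ^ m * (1 - x) ^ (n + 1)) -
        ((n : ℝ) + 1) * (x ^ (m + 1) * (1 - x) ^ n)) = 0 := by
      rw [intervalIntegral.integral_eq_sub_of_hasDerivAt
        (f := fun x : ℝ => x ^ (m + 1) * (1 - x) ^ (n + 1)) (fun x _ => ?_)
        (Continuous.intervalIntegrable (by fun_prop) _ _)]
      · simp
      · refine ((hasDerivAt_pow (m + 1) x).fun_mul
          (((hasDerivAt_id x).const_sub 1).fun_pow (n + 1))).congr_deriv ?_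
        simp
        ring
    rw [intervalIntegral.integral_sub
      (Continuous.intervalIntegrable (by fun_prop) _ _)
      (Continuous.intervalIntegrable (by fun_prop) _ _), intervalIntegral.integral_const_mul,
      intervalIntegral.integral_const_mul, ih, sub_eq_zero] at h
    have hm : (m : ℝ) + 1 ≠ 0 := by positivity
    refine mul_left_cancel₀ hm (h.trans ?_)
    rw [show m + 1 + n + 1 = m + (n + 1) + 1 by ring]
    simp only [Nat.factorial_succ m, Nat.factorial_succ n]
    push_cast
    ring

/-- The values of `integral_abs_affine_pow`, integrated against `a * b` over the unit square. -/
theorem integral_integral_chord_polynomial (k : ℕ) :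
    ∫ b in (0 : ℝ)..1, ∫ a in (0 : ℝ)..1, a * b *
      ((a * b) ^ (k + 1) + ∑ i ∈ Finset.range (k + 1), (1 - a) ^ (k + 2) * b ^ i * a ^ (k - i)
        + ∑ i ∈ Finset.range (k + 2), a ^ (k + 1) * (1 - a) ^ i * (1 - b) ^ (k + 1 - i)) =
      (k + 2).factorial * ∑ j ∈ Finset.range (k + 2), (j.factorial : ℝ) /
        (((k : ℝ) - j + 2) * (k + j + 3).factorial) := by
  have inner (b : ℝ) : ∫ a in (0 : ℝ)..1, a * b *
      ((a * b) ^ (k + 1) + ∑ i ∈ Finset.range (k + 1), (1 - a) ^ (k + 2) * b ^ i * a ^ (k - i)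
        + ∑ i ∈ Finset.range (k + 2), a ^ (k + 1) * (1 - a) ^ i * (1 - b) ^ (k + 1 - i)) =
      b ^ (k + 2) / (k + 3) + ∑ i ∈ Finset.range (k + 1),
        ((k - i + 1).factorial * (k + 2).factorial / (k - i + k + 4).factorial) * b ^ (i + 1) +
      ∑ i ∈ Finset.range (k + 2),
        ((k + 2).factorial * i.factorial / (k + i + 3).factorial) *
          (b ^ 1 * (1 - b) ^ (k + 1 - i)) := by
    have e (a : ℝ) : a * b *
      ((a * b) ^ (k + 1) + ∑ i ∈ Finset.range (k + 1), (1 - a) ^ (k + 2) * b ^ i * a ^ (k - i)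
        + ∑ i ∈ Finset.range (k + 2), a ^ (k + 1) * (1 - a) ^ i * (1 - b) ^ (k + 1 - i)) =
      b ^ (k + 2) * a ^ (k + 2) + ∑ i ∈ Finset.range (k + 1),
        b ^ (i + 1) * (a ^ (k - i + 1) * (1 - a) ^ (k + 2)) +
      ∑ i ∈ Finset.range (k + 2), b ^ 1 * (1 - b) ^ (k + 1 - i) *
        (a ^ (k + 2) * (1 - a) ^ i) := by
      rw [mul_add, mul_add, Finset.mul_sum, Finset.mul_sum]
      congr 1
      · congr 1
        · ring
        · exact Finset.sum_congr rfl fun i _ => by ring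
      · exact Finset.sum_congr rfl fun i _ => by ring
    simp_rw [e]
    rw [intervalIntegral.integral_add (Continuous.intervalIntegrable (by fun_prop) _ _)
      (Continuous.intervalIntegrable (by fun_prop) _ _),
      intervalIntegral.integral_add (Continuous.intervalIntegrable (by fun_prop) _ _)
      (Continuous.intervalIntegrable (by fun_prop) _ _),
      intervalIntegral.integral_finsetSum
        (fun i _ => Continuous.intervalIntegrable (by fun_prop) _ _),
      intervalIntegral.integral_finsetSum
        (fun i _ => Continuous.intervalIntegrable (by fun_prop) _ _)]
    simp_rw [intervalIntegral.integral_const_mul, integral_pow_mul_one_sub_pow, integral_pow]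
    congr 1
    · congr 1
      · push_cast
        simp
        ring
      · refine Finset.sum_congr rfl fun i _ => ?_
        rw [mul_comm, show k - i + 1 + (k + 2) + 1 = k - i + k + 4 by ring]
    · refine Finset.sum_congr rfl fun i _ => ?_
      rw [mul_comm, show k + 2 + i + 1 = k + i + 3 by ring]
  simp_rw [inner]
  rw [intervalIntegral.integral_add (Continuous.intervalIntegrable (by fun_prop) _ _)
      (Continuous.intervalIntegrable (by fun_prop) _ _),
      intervalIntegral.integral_add (Continuous.intervalIntegrable (by fun_prop) _ _)
      (Continuous.intervalIntegrable (by fun_prop) _ _),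
      intervalIntegral.integral_finsetSum
        (fun i _ => Continuous.intervalIntegrable (by fun_prop) _ _),
      intervalIntegral.integral_finsetSum
        (fun i _ => Continuous.intervalIntegrable (by fun_prop) _ _)]
  simp_rw [intervalIntegral.integral_const_mul, intervalIntegral.integral_div,
    integral_pow_mul_one_sub_pow, integral_pow]
  have hB : ∑ i ∈ Finset.range (k + 1), ((k - i + 1).factorial * (k + 2).factorial /
        (k - i + k + 4).factorial : ℝ) *
        (((1 : ℝ) ^ (i + 1 + 1) - 0 ^ (i + 1 + 1)) / ((i + 1 : ℕ) + 1)) =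
      ∑ i ∈ Finset.range (k + 1), ((k + 2).factorial * (i + 1).factorial /
        (k + (i + 1) + 3).factorial : ℝ) * (1 / ((k : ℝ) - (i + 1 : ℕ) + 3)) := by
    rw [← Finset.sum_range_reflect]
    refine Finset.sum_congr rfl fun i hi => ?_
    have hi' : i ≤ k := by simpa [Nat.lt_succ_iff] using hi
    rw [show k + 1 - 1 - i = k - i by omega, show k - (k - i) = i by omega,
      show i + k + 4 = k + (i + 1) + 3 by ring]
    push_cast [hi']
    rw [one_pow, zero_pow (by omega), sub_zero]
    ring
  have hC : ∀ i ∈ Finset.range (k + 2), ((k + 2).factorial * i.factorial /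
        (k + i + 3).factorial : ℝ) *
        (((1).factorial * (k + 1 - i).factorial : ℝ) / (1 + (k + 1 - i) + 1).factorial) =
      (k + 2).factorial * ((i.factorial : ℝ) / (((k : ℝ) - i + 2) * (k + i + 3).factorial)) -
      ((k + 2).factorial * i.factorial / (k + i + 3).factorial : ℝ) * (1 / ((k : ℝ) - i + 3)) := by
    intro i hi
    have hi' : i ≤ k + 1 := by simpa [Nat.lt_succ_iff] using hi
    obtain ⟨m, hm⟩ := Nat.exists_eq_add_of_le hi'
    have hkm : (k : ℝ) = i + m - 1 := by
      rw [eq_sub_iff_add_eq]; exact_mod_cast hm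
    rw [show k + 1 - i = m by omega, show 1 + m + 1 = m + 1 + 1 by ring, Nat.factorial_succ (m + 1),
      Nat.factorial_succ m]
    have h1 : (k : ℝ) - i + 2 = m + 1 := by rw [hkm]; ring
    have h2 : (k : ℝ) - i + 3 = m + 2 := by rw [hkm]; ring
    rw [h1, h2]
    push_cast
    have : (m.factorial : ℝ) ≠ 0 := by positivity
    have : ((k + i + 3).factorial : ℝ) ≠ 0 := by positivity
    field_simp
    simp
    ring
  rw [hB, Finset.sum_congr rfl hC, Finset.sum_sub_distrib, Finset.mul_sum, Finset.sum_range_succ'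
    (fun i => ((k + 2).factorial * i.factorial / (k + i + 3).factorial : ℝ) *
      (1 / ((k : ℝ) - i + 3)))]
  have h0 : ((k + 2).factorial * (0).factorial / (k + 0 + 3).factorial : ℝ) *
      (1 / ((k : ℝ) - (0 : ℕ) + 3)) = 1 / ((k : ℝ) + 3) ^ 2 := by
    rw [show k + 0 + 3 = k + 2 + 1 by ring, Nat.factorial_succ (k + 2)]
    have : ((k + 2).factorial : ℝ) ≠ 0 := by positivity
    push_cast
    simp
    field_simp
    ring
  rw [h0]
  push_cast
  simp
  have : (k : ℝ) + 3 ≠ 0 := by positivity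
  rw [show (k : ℝ) + 2 + 1 = k + 3 by ring]
  field_simp
  ring

end RandomTriangle

namespace RandomTriangle

open Set Filter

/-- Twice the signed area of the triangle with vertices `p`, `q`, `r`. -/
def cross (p q r : ℝ × ℝ) : ℝ := (q.1 - p.1) * (r.2 - p.2) - (r.1 - p.1) * (q.2 - p.2)

/-- The triangle with vertices `(0, 0)`, `(1, 0)`, `(0, 1)`. -/
def stdTriangle : Set (ℝ × ℝ) := {p | 0 ≤ p.1 ∧ 0 ≤ p.2 ∧ p.1 + p.2 ≤ 1}

theorem isClosed_stdTriangle : IsClosed stdTriangle :=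
  (isClosed_le continuous_const continuous_fst).inter
    ((isClosed_le continuous_const continuous_snd).inter
      (isClosed_le (continuous_fst.add continuous_snd) continuous_const))

theorem measurableSet_stdTriangle : MeasurableSet stdTriangle := isClosed_stdTriangle.measurableSet

theorem isCompact_stdTriangle : IsCompact stdTriangle := by
  refine IsCompact.of_isClosed_subset (isCompact_Icc (a := ((0 : ℝ), (0 : ℝ))) (b := (1, 1)))
    isClosed_stdTriangle ?_
  rintro ⟨x, y⟩ ⟨hx, hy, hxy⟩
  simp only at hx hy hxy
  exact ⟨⟨hx, hy⟩, ⟨by simp only; linarith, by simp only; linarith⟩⟩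

@[fun_prop]
theorem continuous_cross {X : Type*} [TopologicalSpace X] {f g h : X → ℝ × ℝ} (hf : Continuous f)
    (hg : Continuous g) (hh : Continuous h) : Continuous fun x => cross (f x) (g x) (h x) := by
  unfold cross
  fun_prop

theorem lintegral_stdTriangle {f : ℝ × ℝ → ENNReal} (hf : Measurable f) :
    ∫⁻ p in stdTriangle, f p = ∫⁻ x in Ioc 0 1, ∫⁻ y in Ioc 0 (1 - x), f (x, y) := by
  rw [Measure.restrict_congr_set (Ioc_ae_eq_Icc (a := (0 : ℝ)) (b := 1)),
    ← lintegral_indicator measurableSet_stdTriangle, Measure.volume_eq_prod,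
    lintegral_prod _ (hf.indicator measurableSet_stdTriangle).aemeasurable,
    ← lintegral_indicator measurableSet_Icc]
  refine lintegral_congr fun x => ?_
  by_cases hx : x ∈ Icc (0 : ℝ) 1
  · rw [indicator_of_mem hx, Measure.restrict_congr_set (Ioc_ae_eq_Icc (a := (0 : ℝ)) (b := 1 - x)),
      ← lintegral_indicator measurableSet_Icc]
    refine lintegral_congr fun y => ?_
    have : (x, y) ∈ stdTriangle ↔ y ∈ Icc 0 (1 - x) := by
      simp only [stdTriangle, mem_ofPred_eq, mem_Icc, le_sub_iff_add_le', hx.1, true_and]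
    simp only [indicator, this]
  · rw [indicator_of_notMem hx]
    refine (lintegral_congr fun y => ?_).trans lintegral_zero
    refine indicator_of_notMem (fun h => hx ?_) _
    obtain ⟨h1, h2, h3⟩ := h
    simp only at h1 h2 h3
    exact ⟨h1, by linarith⟩

theorem lintegral_Ioc_ofReal {f : ℝ → ℝ} (hf : Continuous f) {a b : ℝ} (hab : a ≤ b)
    (h0 : ∀ x ∈ Ioc a b, 0 ≤ f x) :
    ∫⁻ x in Ioc a b, ENNReal.ofReal (f x) = ENNReal.ofReal (∫ x in a..b, f x) := by
  rw [intervalIntegral.integral_of_le hab,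
    ofReal_integral_eq_lintegral_ofReal ((hf.intervalIntegrable a b).1)
      (ae_restrict_of_forall_mem measurableSet_Ioc h0)]

theorem lintegral_stdTriangle_ofReal {f : ℝ × ℝ → ℝ} (hf : Continuous f) (h0 : ∀ p, 0 ≤ f p) :
    ∫⁻ p in stdTriangle, ENNReal.ofReal (f p) =
      ENNReal.ofReal (∫ x in (0)..1, ∫ y in (0)..(1 - x), f (x, y)) := by
  rw [lintegral_stdTriangle hf.measurable.ennreal_ofReal, ← lintegral_Ioc_ofReal
    (intervalIntegral.continuous_parametric_intervalIntegral_of_continuous (by fun_prop)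
      (by fun_prop)) zero_le_one
    fun x hx => intervalIntegral.integral_nonneg (by linarith [hx.2]) fun y _ => h0 _]
  refine setLIntegral_congr_fun measurableSet_Ioc fun x hx => ?_
  exact lintegral_Ioc_ofReal (by fun_prop) (by linarith [hx.2]) fun y _ => h0 _

theorem volume_stdTriangle : volume stdTriangle = ENNReal.ofReal (1 / 2) := by
  have := lintegral_stdTriangle_ofReal (f := fun _ => 1) continuous_const fun _ => zero_le_one
  simp only [ENNReal.ofReal_one, lintegral_one, Measure.restrict_apply_univ] at this
  rw [this]
  congr 1
  simp_rw [intervalIntegral.integral_const, smul_eq_mul, mul_one, sub_zero]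
  rw [intervalIntegral.integral_sub (by simp) (by simp)]
  simp
  norm_num

/-- The affine automorphism of the standard triangle permuting its vertices cyclically. -/
def rotate (p : ℝ × ℝ) : ℝ × ℝ := (1 - p.1 - p.2, p.1)

theorem rotate_preimage_stdTriangle : rotate ⁻¹' stdTriangle = stdTriangle := by
  ext ⟨x, y⟩
  simp only [rotate, stdTriangle, mem_preimage, mem_ofPred_eq]
  constructor <;> rintro ⟨h1, h2, h3⟩ <;> refine ⟨?_, ?_, ?_⟩ <;> linarith

theorem cross_rotate (p q r : ℝ × ℝ) : cross (rotate p) (rotate q) (rotate r) = cross p q r := by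
  simp only [cross, rotate]
  ring

theorem measurePreserving_rotate : MeasurePreserving rotate volume volume := by
  have h1 : MeasurePreserving (fun p : ℝ × ℝ => (p.1, (1 - p.1) - p.2))
      (volume.prod volume) (volume.prod volume) :=
    (MeasurePreserving.id volume).skew_product (g := fun x y => 1 - x - y) (by fun_prop) <|
      Eventually.of_forall fun x => (Measure.measurePreserving_sub_left volume (1 - x)).map_eq
  exact (Measure.measurePreserving_swap (μ := (volume : Measure ℝ))).comp h1

theorem measurePreserving_rotate_restrict :
    MeasurePreserving rotate (volume.restrict stdTriangle) (volume.restrict stdTriangle) := by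
  have := measurePreserving_rotate.restrict_preimage measurableSet_stdTriangle
  rwa [rotate_preimage_stdTriangle] at this

/-- Pairs of points whose connecting line separates the vertex `(0, 0)` of the standard triangle
from the other two vertices. -/
def cutsOrigin : Set ((ℝ × ℝ) × (ℝ × ℝ)) :=
  {z | cross (0, 0) z.1 z.2 * cross (1, 0) z.1 z.2 < 0 ∧
    cross (0, 0) z.1 z.2 * cross (0, 1) z.1 z.2 < 0}

theorem measurableSet_cutsOrigin : MeasurableSet cutsOrigin := by
  have h (v : ℝ × ℝ) : MeasurableSet {z : (ℝ × ℝ) × (ℝ × ℝ) |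
      cross (0, 0) z.1 z.2 * cross v z.1 z.2 < 0} :=
    (isOpen_lt (by fun_prop) continuous_const).measurableSet
  exact (h (1, 0)).inter (h (0, 1))

theorem ae_cross_zero_ne_zero :
    ∀ᵐ z ∂(volume.restrict stdTriangle).prod (volume.restrict stdTriangle),
      cross (0, 0) z.1 z.2 ≠ 0 := by
  have hm : MeasurableSet {z : (ℝ × ℝ) × (ℝ × ℝ) | cross (0, 0) z.1 z.2 ≠ 0} :=
    (isOpen_ne_fun (by fun_prop) continuous_const).measurableSet
  rw [Measure.prod_restrict]
  refine ae_restrict_of_ae ((Measure.ae_prod_iff_ae_ae hm).2 ?_)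
  filter_upwards [Measure.ae_ne volume (0 : ℝ × ℝ)] with p hp
  let ℓ : ℝ × ℝ →ₗ[ℝ] ℝ := p.1 • LinearMap.snd ℝ ℝ ℝ - p.2 • LinearMap.fst ℝ ℝ ℝ
  have hℓ (q) : ℓ q = cross (0, 0) p q := by simp [ℓ, cross]; ring
  have hker : LinearMap.ker ℓ ≠ ⊤ := by
    intro h
    rw [LinearMap.ker_eq_top] at h
    apply hp
    ext
    · simpa [ℓ] using LinearMap.congr_fun h (0, 1)
    · simpa [ℓ] using LinearMap.congr_fun h (1, 0)
  have := Measure.addHaar_submodule volume _ hker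
  rw [measure_eq_zero_iff_ae_notMem] at this
  filter_upwards [this] with q hq
  rw [← hℓ]
  exact hq

theorem barycentric_pos {w x y α β γ : ℝ} (hw : 0 ≤ w) (hx : 0 ≤ x) (hy : 0 ≤ y)
    (h : w + x + y = 1) (hα : 0 < α) (hβ : 0 < β) (hγ : 0 < γ) : 0 < w * α + x * β + y * γ := by
  rcases hw.eq_or_lt with rfl | hw
  · rcases hx.eq_or_lt with rfl | hx
    · have : y = 1 := by linarith
      subst this
      linarith
    · positivity
  · positivity

/-- By symmetry, only lines separating a given vertex need to be considered. -/
theorem lintegral_eq_three_mul_cutsOrigin {H : (ℝ × ℝ) × (ℝ × ℝ) → ENNReal} (hH : Measurable H)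
    (hrot : ∀ z, H (Prod.map rotate rotate z) = H z) :
    ∫⁻ z, H z ∂(volume.restrict stdTriangle).prod (volume.restrict stdTriangle) =
      3 * ∫⁻ z in cutsOrigin, H z
        ∂(volume.restrict stdTriangle).prod (volume.restrict stdTriangle) := by
  set ν := (volume.restrict stdTriangle).prod (volume.restrict stdTriangle) with hν
  have hτ : MeasurePreserving (Prod.map rotate rotate) ν ν :=
    measurePreserving_rotate_restrict.prod measurePreserving_rotate_restrict
  set τ := Prod.map rotate rotate with hτ_def
  have hE := measurableSet_cutsOrigin
  have hA (z) : cross (0, 0) (τ z).1 (τ z).2 = cross (0, 1) z.1 z.2 := by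
    rw [← cross_rotate (0, 1)]; simp [rotate, hτ_def]
  have hB (z) : cross (1, 0) (τ z).1 (τ z).2 = cross (0, 0) z.1 z.2 := by
    rw [← cross_rotate (0, 0)]; simp [rotate, hτ_def]
  have hC (z) : cross (0, 1) (τ z).1 (τ z).2 = cross (1, 0) z.1 z.2 := by
    rw [← cross_rotate (1, 0)]; simp [rotate, hτ_def]
  have hpre {s} (hs : MeasurableSet s) : ∫⁻ z in τ ⁻¹' s, H z ∂ν = ∫⁻ z in s, H z ∂ν := by
    rw [← hτ.setLIntegral_comp_preimage hs hH]
    simp_rw [hrot]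
  have hE' := hτ.measurable hE
  have hE'' := hτ.measurable hE'
  have hS : ∀ᵐ z ∂ν, z.1 ∈ stdTriangle := by
    rw [hν, Measure.prod_restrict]
    filter_upwards [ae_restrict_mem (measurableSet_stdTriangle.prod measurableSet_stdTriangle)]
      with z hz using hz.1
  have hα : ∀ᵐ z ∂ν, cross (0, 0) z.1 z.2 ≠ 0 := ae_cross_zero_ne_zero
  have hγ : ∀ᵐ z ∂ν, cross (0, 1) z.1 z.2 ≠ 0 := by
    filter_upwards [hτ.quasiMeasurePreserving.ae hα] with z hz
    rwa [← hA]
  have hβ : ∀ᵐ z ∂ν, cross (1, 0) z.1 z.2 ≠ 0 := by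
    filter_upwards [hτ.quasiMeasurePreserving.ae hγ] with z hz
    rwa [← hC]
  have hcover : (cutsOrigin ∪ (τ ⁻¹' cutsOrigin ∪ τ ⁻¹' (τ ⁻¹' cutsOrigin)) : Set _) =ᵐ[ν]
      (univ : Set _) := by
    rw [eventuallyEq_univ]
    filter_upwards [hS, hα, hβ, hγ] with z hz h1 h2 h3
    simp only [mem_union, mem_preimage, cutsOrigin, mem_ofPred_eq, hA, hB, hC]
    have hbar : (1 - z.1.1 - z.1.2) * cross (0, 0) z.1 z.2 + z.1.1 * cross (1, 0) z.1 z.2 +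
        z.1.2 * cross (0, 1) z.1 z.2 = 0 := by
      simp only [cross]; ring
    obtain ⟨hx, hy, hxy⟩ := hz
    generalize cross (0, 0) z.1 z.2 = α at *
    generalize cross (1, 0) z.1 z.2 = β at *
    generalize cross (0, 1) z.1 z.2 = γ at *
    have hw : 0 ≤ 1 - z.1.1 - z.1.2 := by linarith
    rcases h1.lt_or_gt with a | a <;> rcases h2.lt_or_gt with b | b <;>
      rcases h3.lt_or_gt with c | c
    all_goals first
      | exact Or.inl ⟨by nlinarith, by nlinarith⟩
      | exact Or.inr (Or.inl ⟨by nlinarith, by nlinarith⟩)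
      | exact Or.inr (Or.inr ⟨by nlinarith, by nlinarith⟩)
      | exact absurd hbar (barycentric_pos hw hx hy (by ring) a b c).ne'
      | exact absurd hbar (by
          have := barycentric_pos hw hx hy (by ring) (neg_pos.2 a) (neg_pos.2 b) (neg_pos.2 c)
          linarith)
  have hd1 : Disjoint cutsOrigin (τ ⁻¹' cutsOrigin ∪ τ ⁻¹' (τ ⁻¹' cutsOrigin)) := by
    rw [Set.disjoint_left]
    simp only [mem_union, mem_preimage, cutsOrigin, mem_ofPred_eq, hA, hB, hC]
    rintro z ⟨h1, h2⟩ (⟨h3, h4⟩ | ⟨h3, h4⟩) <;>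
      nlinarith [mul_pos_of_neg_of_neg h1 h2, sq_nonneg (cross (0, 0) z.1 z.2)]
  have hd2 : Disjoint (τ ⁻¹' cutsOrigin) (τ ⁻¹' (τ ⁻¹' cutsOrigin)) := by
    rw [Set.disjoint_left]
    simp only [mem_preimage, cutsOrigin, mem_ofPred_eq, hA, hB, hC]
    rintro z ⟨h1, h2⟩ ⟨h3, h4⟩
    nlinarith [mul_pos_of_neg_of_neg h1 h2, sq_nonneg (cross (0, 1) z.1 z.2)]
  rw [← setLIntegral_univ (μ := ν), ← setLIntegral_congr hcover,
    lintegral_union (hE'.union hE'') hd1, lintegral_union hE'' hd2, hpre hE', hpre hE]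
  ring

/-- Change of variables from the ordinates of two points with abscissae `x₁`, `x₂` to the slope and
intercept of the line joining them. -/
theorem lintegral_lintegral_eq_slope_intercept {g : ℝ × ℝ → ENNReal} (hg : Measurable g) {x₁ x₂ : ℝ}
    (hx : x₁ ≠ x₂) :
    ∫⁻ y₁, ∫⁻ y₂, g (y₁, y₂) =
      ∫⁻ c, ∫⁻ b, ENNReal.ofReal |x₂ - x₁| * g (b - c * x₁, b - c * x₂) := by
  have hm : x₂ - x₁ ≠ 0 := sub_ne_zero.2 hx.symm
  have h1 (y₁ : ℝ) : ∫⁻ y₂, g (y₁, y₂) =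
      ∫⁻ c, ENNReal.ofReal |x₂ - x₁| * g (y₁, y₁ - c * (x₂ - x₁)) := by
    have hr : range (fun c : ℝ => y₁ - c * (x₂ - x₁)) = univ := by
      refine range_eq_univ.2 fun y => ⟨(y₁ - y) / (x₂ - x₁), ?_⟩
      field_simp
      ring
    have hinj : InjOn (fun c : ℝ => y₁ - c * (x₂ - x₁)) univ := by
      intro c _ d _ h
      exact mul_right_cancel₀ hm (sub_right_injective h)
    have := lintegral_image_eq_lintegral_abs_deriv_mul (s := univ) MeasurableSet.univ
      (f := fun c : ℝ => y₁ - c * (x₂ - x₁)) (f' := fun _ => -(x₂ - x₁))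
      (fun c _ => (((hasDerivAt_id c).mul_const (x₂ - x₁)).const_sub y₁).hasDerivWithinAt.congr_deriv
        (by simp)) hinj (fun y₂ => g (y₁, y₂))
    simpa only [image_univ, hr, setLIntegral_univ, abs_neg] using this
  simp_rw [h1]
  rw [lintegral_lintegral_swap (by fun_prop)]
  refine lintegral_congr fun c => ?_
  rw [← lintegral_sub_right_eq_self _ (c * x₁)]
  refine lintegral_congr fun b => ?_
  ring_nf

theorem cross_line (r : ℝ × ℝ) (b c x₁ x₂ : ℝ) :
    cross r (x₁, b - c * x₁) (x₂, b - c * x₂) = -((x₁ - x₂) * (r.2 - b + c * r.1)) := by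
  simp only [cross]
  ring

theorem mem_cutsOrigin_line_iff {b c x₁ x₂ : ℝ} (hx : x₁ ≠ x₂) :
    ((x₁, b - c * x₁) ∈ stdTriangle ∧ (x₂, b - c * x₂) ∈ stdTriangle) ∧
      ((x₁, b - c * x₁), (x₂, b - c * x₂)) ∈ cutsOrigin ↔
    (b ∈ Ioo 0 1 ∧ c ∈ Ioi b) ∧ x₁ ∈ Icc 0 (b / c) ∧ x₂ ∈ Icc 0 (b / c) := by
  have hpos : 0 < (x₁ - x₂) ^ 2 := by
    have := sub_ne_zero.2 hx
    positivity
  have key : ((x₁, b - c * x₁), (x₂, b - c * x₂)) ∈ cutsOrigin ↔ b ∈ Ioo 0 1 ∧ c ∈ Ioi b := by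
    simp only [cutsOrigin, mem_ofPred_eq, cross_line, mem_Ioo, mem_Ioi]
    have e1 : -((x₁ - x₂) * (0 - b + c * 0)) * -((x₁ - x₂) * (0 - b + c * 1)) =
        (x₁ - x₂) ^ 2 * (b * (b - c)) := by ring
    have e2 : -((x₁ - x₂) * (0 - b + c * 0)) * -((x₁ - x₂) * (1 - b + c * 0)) =
        (x₁ - x₂) ^ 2 * (b * (b - 1)) := by ring
    have hneg (t : ℝ) : (x₁ - x₂) ^ 2 * t < 0 ↔ t < 0 :=
      ⟨fun h => neg_of_mul_neg_right h hpos.le, mul_neg_of_pos_of_neg hpos⟩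
    rw [e1, e2, hneg, hneg]
    constructor
    · rintro ⟨h1, h2⟩
      have hb : 0 < b := by nlinarith
      exact ⟨⟨hb, by nlinarith⟩, by nlinarith⟩
    · rintro ⟨⟨h1, h2⟩, h3⟩
      exact ⟨by nlinarith, by nlinarith⟩
  rw [key, and_comm]
  refine and_congr_right ?_
  rintro ⟨⟨hb, hb'⟩, hc⟩
  rw [mem_Ioi] at hc
  have hc0 : 0 < c := hb.trans hc
  have hmem (x : ℝ) : (x, b - c * x) ∈ stdTriangle ↔ x ∈ Icc 0 (b / c) := by
    simp only [stdTriangle, mem_ofPred_eq, mem_Icc, le_div_iff₀ hc0]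
    constructor
    · rintro ⟨h1, h2, h3⟩
      exact ⟨h1, by linarith⟩
    · rintro ⟨h1, h2⟩
      refine ⟨h1, by linarith, ?_⟩
      rcases le_total 1 c with h | h <;> nlinarith
  rw [hmem, hmem]

theorem lintegral_lintegral_Icc_abs_sub_pow (n : ℕ) {L : ℝ} (hL : 0 ≤ L) :
    ∫⁻ x in Icc 0 L, ∫⁻ y in Icc 0 L, ENNReal.ofReal (|x - y| ^ n) =
      ENNReal.ofReal (2 * L ^ (n + 2) / ((n + 1) * (n + 2))) := by
  rw [← integral_integral_abs_sub_pow n hL, ← Measure.restrict_congr_set Ioc_ae_eq_Icc,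
    ← lintegral_Ioc_ofReal
      (intervalIntegral.continuous_parametric_intervalIntegral_of_continuous (by fun_prop)
        (by fun_prop)) hL
      fun x _ => intervalIntegral.integral_nonneg hL fun y _ => by positivity]
  refine lintegral_congr fun x => ?_
  exact lintegral_Ioc_ofReal (by fun_prop) hL fun y _ => by positivity

theorem lintegral_Ioi_eq_lintegral_Ioo {b : ℝ} (hb : 0 < b) (f : ℝ → ENNReal) :
    ∫⁻ c in Ioi b, f c = ∫⁻ a in Ioo 0 1, ENNReal.ofReal (b / a ^ 2) * f (b / a) := by
  have himg : (fun a => b / a) '' Ioo (0 : ℝ) 1 = Ioi b := by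
    ext c
    simp only [mem_image, mem_Ioo, mem_Ioi]
    constructor
    · rintro ⟨a, ⟨h0, h1⟩, rfl⟩
      rw [lt_div_iff₀ h0]
      nlinarith
    · intro hc
      have hc0 := hb.trans hc
      exact ⟨b / c, ⟨by positivity, (div_lt_one hc0).2 hc⟩, by field_simp⟩
  rw [← himg, lintegral_image_eq_lintegral_abs_deriv_mul measurableSet_Ioo
    (f' := fun a => -(b / a ^ 2))]
  · refine setLIntegral_congr_fun measurableSet_Ioo fun a _ => ?_
    simp only [abs_neg]
    rw [abs_of_nonneg (by positivity)]
  · intro a ha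
    have := ((hasDerivAt_inv ha.1.ne').const_mul b).hasDerivWithinAt (s := Ioo 0 1)
    simp only [div_eq_mul_inv]
    exact this.congr_deriv (by ring)
  · intro a ha a' ha' h
    have h0 := ha.1.ne'
    have h0' := ha'.1.ne'
    simp only at h
    field_simp at h
    exact h.symm

/-- The contribution of the lines separating `(0, 0)` from the other vertices, where `a` and `b`
are the intercepts of the line. -/
theorem lintegral_cutsOrigin (k : ℕ) :
    ∫⁻ z in cutsOrigin, (∫⁻ r in stdTriangle, ENNReal.ofReal (|cross r z.1 z.2| ^ k))
      ∂(volume.restrict stdTriangle).prod (volume.restrict stdTriangle) =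
    ENNReal.ofReal (2 / ((k + 2) * (k + 3))) * ∫⁻ b in Ioo (0 : ℝ) 1, ∫⁻ a in Ioo (0 : ℝ) 1,
      ENNReal.ofReal (a * b) *
        ∫⁻ r in stdTriangle, ENNReal.ofReal (|a * r.2 - a * b + b * r.1| ^ k) := by
  set H : (ℝ × ℝ) × (ℝ × ℝ) → ENNReal := fun z =>
    ∫⁻ r in stdTriangle, ENNReal.ofReal (|cross r z.1 z.2| ^ k) with hH_def
  have hH : Measurable H := by
    refine Measurable.lintegral_prod_right' (f := fun w : ((ℝ × ℝ) × (ℝ × ℝ)) × (ℝ × ℝ) =>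
      ENNReal.ofReal (|cross w.2 w.1.1 w.1.2| ^ k)) ?_
    exact (Continuous.measurable (by fun_prop)).ennreal_ofReal
  set N : ℝ × ℝ → ENNReal := fun w =>
    ∫⁻ r in stdTriangle, ENNReal.ofReal (|r.2 - w.2 + w.1 * r.1| ^ k) with hN_def
  have hN : Measurable N := by
    refine Measurable.lintegral_prod_right' (f := fun w : (ℝ × ℝ) × (ℝ × ℝ) =>
      ENNReal.ofReal (|w.2.2 - w.1.2 + w.1.1 * w.2.1| ^ k)) ?_
    exact (Continuous.measurable (by fun_prop)).ennreal_ofReal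
  set G := (stdTriangle ×ˢ stdTriangle ∩ cutsOrigin).indicator H with hG_def
  have hset : MeasurableSet (stdTriangle ×ˢ stdTriangle ∩ cutsOrigin) :=
    (measurableSet_stdTriangle.prod measurableSet_stdTriangle).inter measurableSet_cutsOrigin
  have hG : Measurable G := hH.indicator hset
  -- `v` holds the abscissae, `w` the slope and the intercept
  set R : Set ((ℝ × ℝ) × (ℝ × ℝ)) := {u | (u.2.2 ∈ Ioo 0 1 ∧ u.2.1 ∈ Ioi u.2.2) ∧
    u.1.1 ∈ Icc 0 (u.2.2 / u.2.1) ∧ u.1.2 ∈ Icc 0 (u.2.2 / u.2.1)} with hR_def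
  have hR : MeasurableSet R := by
    simp only [hR_def, mem_Ioo, mem_Ioi, mem_Icc]
    measurability
  set K := R.indicator fun u => ENNReal.ofReal (|u.1.1 - u.1.2| ^ (k + 1)) * N u.2 with hK_def
  have hK : Measurable K := by
    refine Measurable.indicator ?_ hR
    exact ((Continuous.measurable (by fun_prop)).ennreal_ofReal).mul (hN.comp measurable_snd)
  have hline {x₁ x₂ : ℝ} (hx : x₁ ≠ x₂) (c b : ℝ) :
      ENNReal.ofReal |x₂ - x₁| * G ((x₁, b - c * x₁), (x₂, b - c * x₂)) =
        K ((x₁, x₂), (c, b)) := by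
    have hiff : ((x₁, b - c * x₁), (x₂, b - c * x₂)) ∈
        stdTriangle ×ˢ stdTriangle ∩ cutsOrigin ↔ ((x₁, x₂), (c, b)) ∈ R :=
      mem_cutsOrigin_line_iff hx
    by_cases h : ((x₁, x₂), (c, b)) ∈ R
    · rw [hG_def, hK_def, indicator_of_mem h, indicator_of_mem (hiff.2 h)]
      simp only [hH_def, hN_def, cross_line, abs_neg, abs_mul, mul_pow]
      simp_rw [ENNReal.ofReal_mul (pow_nonneg (abs_nonneg _) _)]
      rw [lintegral_const_mul _ (by fun_prop), ← mul_assoc, ← ENNReal.ofReal_mul (abs_nonneg _),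
        abs_sub_comm x₂ x₁, pow_succ']
    · rw [hG_def, hK_def, indicator_of_notMem h, indicator_of_notMem (mt hiff.1 h), mul_zero]
  have hlines : ∫⁻ z in cutsOrigin, H z
      ∂(volume.restrict stdTriangle).prod (volume.restrict stdTriangle) =
      ∫⁻ v : ℝ × ℝ, ∫⁻ w : ℝ × ℝ, K (v, w) := by
    rw [Measure.prod_restrict, Measure.restrict_restrict measurableSet_cutsOrigin, inter_comm,
      ← lintegral_indicator hset, lintegral_prod _ hG.aemeasurable, Measure.volume_eq_prod,
      lintegral_prod _ (by fun_prop), lintegral_prod _ (by fun_prop)]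
    refine lintegral_congr fun x₁ => ?_
    have : ∀ y₁, ∫⁻ q, G ((x₁, y₁), q) ∂(volume.prod volume) =
        ∫⁻ x₂, ∫⁻ y₂, G ((x₁, y₁), (x₂, y₂)) := fun y₁ =>
      lintegral_prod _ (by fun_prop)
    simp_rw [this]
    rw [lintegral_lintegral_swap (by fun_prop)]
    refine lintegral_congr_ae ?_
    filter_upwards [Measure.ae_ne volume x₁] with x₂ hx
    rw [lintegral_lintegral_eq_slope_intercept (g := fun y => G ((x₁, y.1), (x₂, y.2)))
      (by fun_prop) hx.symm, lintegral_prod _ (by fun_prop)]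
    simp_rw [hline hx.symm]
  have hfiber (b c : ℝ) : ∫⁻ v, K (v, (c, b)) = (Ioo (0 : ℝ) 1).indicator (fun b =>
      (Ioi b).indicator (fun c => N (c, b) *
        ENNReal.ofReal (2 * (b / c) ^ (k + 3) / ((k + 2) * (k + 3)))) c) b := by
    by_cases h : b ∈ Ioo (0 : ℝ) 1 ∧ c ∈ Ioi b
    · have hbc : 0 ≤ b / c := div_nonneg h.1.1.le (h.1.1.le.trans (mem_Ioi.1 h.2).le)
      rw [indicator_of_mem h.1, indicator_of_mem h.2, Measure.volume_eq_prod,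
        lintegral_prod _ (by fun_prop)]
      have := lintegral_lintegral_Icc_abs_sub_pow (k + 1) hbc
      push_cast at this
      rw [show (k : ℝ) + 1 + 1 = k + 2 by ring, show (k : ℝ) + 1 + 2 = k + 3 by ring,
        ← lintegral_indicator measurableSet_Icc] at this
      rw [← this, ← lintegral_const_mul _ ?_]
      · refine lintegral_congr fun x => ?_
        by_cases hx : x ∈ Icc 0 (b / c)
        · rw [indicator_of_mem hx, ← lintegral_indicator measurableSet_Icc,
            ← lintegral_const_mul _ ?_]
          · refine lintegral_congr fun y => ?_
            by_cases hy : y ∈ Icc 0 (b / c)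
            · rw [indicator_of_mem hy, hK_def,
                indicator_of_mem (show ((x, y), (c, b)) ∈ R from ⟨h, hx, hy⟩), mul_comm]
            · rw [indicator_of_notMem hy, hK_def, indicator_of_notMem fun h' => hy h'.2.2,
                mul_zero]
          · exact Measurable.indicator (by fun_prop) measurableSet_Icc
        · rw [indicator_of_notMem hx, mul_zero]
          refine (lintegral_congr fun y => ?_).trans lintegral_zero
          exact indicator_of_notMem (fun h' => hx h'.2.1) _
      · exact Measurable.indicator (by fun_prop) measurableSet_Icc
    · have h0 : ∫⁻ v, K (v, (c, b)) = 0 :=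
        (lintegral_congr fun v => indicator_of_notMem (fun h' => h h'.1) _).trans lintegral_zero
      rw [h0]
      by_cases hb : b ∈ Ioo (0 : ℝ) 1
      · rw [indicator_of_mem hb, indicator_of_notMem fun hc => h ⟨hb, hc⟩]
      · rw [indicator_of_notMem hb]
  rw [hlines, lintegral_lintegral_swap (by fun_prop), Measure.volume_eq_prod,
    lintegral_prod_symm _ (by fun_prop), ← Measure.volume_eq_prod]
  simp_rw [hfiber]
  rw [← lintegral_const_mul' _ _ ENNReal.ofReal_ne_top, ← lintegral_indicator measurableSet_Ioo]
  refine lintegral_congr fun b => ?_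
  by_cases hb : b ∈ Ioo (0 : ℝ) 1
  · simp_rw [indicator_of_mem hb]
    rw [lintegral_indicator measurableSet_Ioi, lintegral_Ioi_eq_lintegral_Ioo hb.1,
      ← lintegral_const_mul' _ _ ENNReal.ofReal_ne_top]
    refine setLIntegral_congr_fun measurableSet_Ioo fun a ha => ?_
    have ha0 := ha.1
    have hb0 := hb.1
    have hN' : ∫⁻ r in stdTriangle, ENNReal.ofReal (|a * r.2 - a * b + b * r.1| ^ k) =
        ENNReal.ofReal (a ^ k) * N (b / a, b) := by
      rw [hN_def, ← lintegral_const_mul' _ _ ENNReal.ofReal_ne_top]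
      refine lintegral_congr fun r => ?_
      rw [← ENNReal.ofReal_mul (by positivity)]
      nth_rewrite 3 [← abs_of_pos ha0]
      rw [← mul_pow, ← abs_mul]
      congr 3
      field_simp
    rw [hN', show b / (b / a) = a by field_simp, ← mul_assoc, ← mul_assoc, mul_right_comm,
      ← ENNReal.ofReal_mul (by positivity), ← ENNReal.ofReal_mul (by positivity), ← mul_assoc,
      ← ENNReal.ofReal_mul (by positivity)]
    congr 2
    field_simp
    ring
  · simp_rw [indicator_of_notMem hb]
    exact lintegral_zero

/-- The moment integral over the standard triangle. -/
theorem lintegral_cross_stdTriangle (k : ℕ) :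
    ∫⁻ z, (∫⁻ r in stdTriangle, ENNReal.ofReal (|cross r z.1 z.2| ^ k))
      ∂(volume.restrict stdTriangle).prod (volume.restrict stdTriangle) =
    ENNReal.ofReal (6 * k.factorial / ((k + 2) * (k + 3)) * ∑ j ∈ Finset.range (k + 2),
      (j.factorial : ℝ) / (((k : ℝ) - j + 2) * (k + j + 3).factorial)) := by
  rw [lintegral_eq_three_mul_cutsOrigin ?_ ?_, lintegral_cutsOrigin]
  · have hP (b : ℝ) (hb : b ∈ Ioo (0 : ℝ) 1) : ∫⁻ a in Ioo (0 : ℝ) 1, ENNReal.ofReal (a * b) *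
        ∫⁻ r in stdTriangle, ENNReal.ofReal (|a * r.2 - a * b + b * r.1| ^ k) =
        ENNReal.ofReal (∫ a in (0 : ℝ)..1, a * b *
        ((a * b) ^ (k + 1) + ∑ i ∈ Finset.range (k + 1), (1 - a) ^ (k + 2) * b ^ i * a ^ (k - i)
        + ∑ i ∈ Finset.range (k + 2), a ^ (k + 1) * (1 - a) ^ i * (1 - b) ^ (k + 1 - i)) /
          ((k + 1) * (k + 2))) := by
      rw [Measure.restrict_congr_set Ioo_ae_eq_Ioc, ← lintegral_Ioc_ofReal (by fun_prop)
        zero_le_one ?_, ← Measure.restrict_congr_set Ioo_ae_eq_Ioc]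
      · refine lintegral_congr_ae ?_
        filter_upwards [ae_restrict_mem measurableSet_Ioo,
          ae_restrict_of_ae (Measure.ae_ne volume b)] with a ha hab
        have ha0 := ha.1
        have hb0 := hb.1
        rw [lintegral_stdTriangle_ofReal (by fun_prop) fun p => by positivity,
          integral_abs_affine_pow k ha.1 ha.2 hb.1 hb.2 hab, ← ENNReal.ofReal_mul (by positivity),
          mul_div_assoc]
      · rintro a ⟨ha0, ha1⟩
        have hb0 := hb.1
        have hb1 : 0 ≤ 1 - b := sub_nonneg.2 hb.2.le
        have ha1 : 0 ≤ 1 - a := sub_nonneg.2 ha1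
        positivity
    rw [setLIntegral_congr_fun measurableSet_Ioo hP, Measure.restrict_congr_set Ioo_ae_eq_Ioc,
      lintegral_Ioc_ofReal ?_ zero_le_one ?_]
    · simp_rw [intervalIntegral.integral_div]
      rw [integral_integral_chord_polynomial, ← ENNReal.ofReal_mul (by positivity),
        show (3 : ENNReal) = ENNReal.ofReal 3 by simp, ← ENNReal.ofReal_mul (by positivity),
        Nat.factorial_succ, Nat.factorial_succ]
      congr 1
      push_cast
      field_simp
      ring
    · exact intervalIntegral.continuous_parametric_intervalIntegral_of_continuous' (by fun_prop) _ _
    · rintro b ⟨hb0, hb1⟩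
      refine intervalIntegral.integral_nonneg zero_le_one fun a ⟨ha0, ha1⟩ => ?_
      have hb1 : 0 ≤ 1 - b := sub_nonneg.2 hb1
      have ha1 : 0 ≤ 1 - a := sub_nonneg.2 ha1
      positivity
  · refine Measurable.lintegral_prod_right' (f := fun w : ((ℝ × ℝ) × (ℝ × ℝ)) × (ℝ × ℝ) =>
      ENNReal.ofReal (|cross w.2 w.1.1 w.1.2| ^ k)) ?_
    exact (Continuous.measurable (by fun_prop)).ennreal_ofReal
  · intro z
    rw [← measurePreserving_rotate_restrict.lintegral_comp ?_]
    · simp only [Prod.map_fst, Prod.map_snd, cross_rotate]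
    · exact (Continuous.measurable (by fun_prop)).ennreal_ofReal

/-- Cartesian coordinates on the Euclidean plane. -/
noncomputable def coords : EuclideanSpace ℝ (Fin 2) ≃L[ℝ] ℝ × ℝ :=
  (EuclideanSpace.equiv (Fin 2) ℝ).trans (ContinuousLinearEquiv.finTwoArrow ℝ ℝ)

theorem measurePreserving_coords : MeasurePreserving coords volume volume :=
  (volume_preserving_finTwoArrow ℝ).comp (PiLp.volume_preserving_ofLp (Fin 2))

/-- The linear part of the affine map sending the vertices `(0, 0)`, `(1, 0)`, `(0, 1)` of the
standard triangle to `p`, `q`, `r`. -/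
noncomputable def edgeMap (p q r : ℝ × ℝ) : ℝ × ℝ →ₗ[ℝ] ℝ × ℝ :=
  Matrix.toLin (Module.Basis.finTwoProd ℝ) (Module.Basis.finTwoProd ℝ)
    !![q.1 - p.1, r.1 - p.1; q.2 - p.2, r.2 - p.2]

theorem edgeMap_apply (p q r z : ℝ × ℝ) : edgeMap p q r z =
    ((q.1 - p.1) * z.1 + (r.1 - p.1) * z.2, (q.2 - p.2) * z.1 + (r.2 - p.2) * z.2) :=
  Matrix.toLin_finTwoProd_apply _ _ _ _ _

theorem det_edgeMap (p q r : ℝ × ℝ) : LinearMap.det (edgeMap p q r) = cross p q r := by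
  rw [edgeMap, LinearMap.det_toLin, Matrix.det_fin_two_of, cross]

theorem cross_add_edgeMap (p q r x y z : ℝ × ℝ) :
    cross (p + edgeMap p q r x) (p + edgeMap p q r y) (p + edgeMap p q r z) =
      cross p q r * cross x y z := by
  simp only [edgeMap_apply, cross, Prod.fst_add, Prod.snd_add]
  ring

theorem convexHull_eq_stdTriangle :
    convexHull ℝ {((0 : ℝ), (0 : ℝ)), (1, 0), (0, 1)} = stdTriangle := by
  refine Subset.antisymm (convexHull_min ?_ ?_) ?_
  · rintro z (rfl | rfl | rfl) <;> norm_num [stdTriangle]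
  · rintro ⟨x, y⟩ ⟨h1, h2, h3⟩ ⟨x', y'⟩ ⟨h1', h2', h3'⟩ a b ha hb hab
    simp only at h1 h2 h3 h1' h2' h3'
    simp only [stdTriangle, mem_ofPred_eq, Prod.smul_mk, Prod.mk_add_mk, smul_eq_mul]
    refine ⟨by positivity, by positivity, ?_⟩
    nlinarith
  · rintro ⟨x, y⟩ ⟨h1, h2, h3⟩
    simp only at h1 h2 h3
    rw [convexHull_insert (by simp), mem_convexJoin]
    simp only [mem_singleton_iff, exists_eq_left, convexHull_pair]
    rcases eq_or_ne (x + y) 0 with h | h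
    · obtain rfl : x = 0 := by linarith
      obtain rfl : y = 0 := by linarith
      exact ⟨_, left_mem_segment _ _ _, left_mem_segment _ _ _⟩
    · have hpos : 0 < x + y := lt_of_le_of_ne (by linarith) h.symm
      refine ⟨(x / (x + y), y / (x + y)), ⟨x / (x + y), y / (x + y), by positivity, by positivity,
        by field_simp, by simp⟩, ⟨1 - (x + y), x + y, by linarith, hpos.le, by ring, ?_⟩⟩
      ext <;> simp <;> field_simp

theorem convexHull_triple_eq_image (p q r : ℝ × ℝ) :
    convexHull ℝ {p, q, r} = (fun z => p + edgeMap p q r z) '' stdTriangle := by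
  have := AffineMap.image_convexHull (AffineMap.const ℝ (ℝ × ℝ) p + (edgeMap p q r).toAffineMap)
    {((0 : ℝ), (0 : ℝ)), (1, 0), (0, 1)}
  rw [convexHull_eq_stdTriangle] at this
  refine Eq.trans ?_ (this.symm.trans (image_congr fun z _ => by simp))
  simp only [image_insert_eq, image_singleton, AffineMap.coe_add, Pi.add_apply,
    AffineMap.const_apply, LinearMap.coe_toAffineMap, edgeMap_apply]
  congr <;> ext <;> simp

theorem image_coords_convexHull (A B C : EuclideanSpace ℝ (Fin 2)) :
    coords '' convexHull ℝ {A, B, C} = convexHull ℝ {coords A, coords B, coords C} := by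
  have := coords.toLinearMap.image_convexHull {A, B, C}
  simpa [image_insert_eq] using this

theorem convexHull_triple_eq_preimage (A B C : EuclideanSpace ℝ (Fin 2)) :
    convexHull ℝ {A, B, C} = coords ⁻¹' ((fun z => coords A +
      edgeMap (coords A) (coords B) (coords C) z) '' stdTriangle) := by
  rw [← convexHull_triple_eq_image, ← image_coords_convexHull,
    preimage_image_eq _ coords.injective]

theorem measurableEmbedding_coords : MeasurableEmbedding coords :=
  coords.toHomeomorph.measurableEmbedding

theorem volume_convexHull_triple (A B C : EuclideanSpace ℝ (Fin 2)) :
    volume (convexHull ℝ {A, B, C}) =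
      ENNReal.ofReal (|cross (coords A) (coords B) (coords C)| / 2) := by
  rw [convexHull_triple_eq_preimage,
    measurePreserving_coords.measure_preimage_emb measurableEmbedding_coords,
    ← image_image (fun z => coords A + z), image_add_left, measure_preimage_add,
    Measure.addHaar_image_linearMap, det_edgeMap, volume_stdTriangle,
    ← ENNReal.ofReal_mul (abs_nonneg _), mul_one_div]

theorem setIntegral_convexHull_triple {A B C : EuclideanSpace ℝ (Fin 2)}
    (h : cross (coords A) (coords B) (coords C) ≠ 0) (F : EuclideanSpace ℝ (Fin 2) → ℝ) :
    ∫ x in convexHull ℝ {A, B, C}, F x = |cross (coords A) (coords B) (coords C)| *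
      ∫ z in stdTriangle, F (coords.symm (coords A +
        edgeMap (coords A) (coords B) (coords C) z)) := by
  set L := edgeMap (coords A) (coords B) (coords C) with hL
  have hinj : Function.Injective L := by
    rw [← LinearMap.ker_eq_bot]
    by_contra hker
    exact h (by rw [← det_edgeMap]; exact LinearMap.det_eq_zero_iff_ker_ne_bot.2 hker)
  have h1 := measurePreserving_coords.setIntegral_preimage_emb measurableEmbedding_coords
    (fun z => F (coords.symm z)) ((fun z => coords A + L z) '' stdTriangle)
  simp only [ContinuousLinearEquiv.symm_apply_apply] at h1
  have hderiv (z : ℝ × ℝ) : HasFDerivAt (fun z => coords A + L z)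
      (LinearMap.toContinuousLinearMap L) z :=
    (LinearMap.toContinuousLinearMap L).hasFDerivAt.const_add _
  rw [convexHull_triple_eq_preimage, h1, integral_image_eq_integral_abs_det_fderiv_smul volume
    measurableSet_stdTriangle (fun z _ => (hderiv z).hasFDerivWithinAt)
    (fun z _ w _ hzw => hinj (add_left_cancel hzw))]
  simp only [LinearMap.det_toContinuousLinearMap, hL, det_edgeMap, smul_eq_mul]
  exact integral_const_mul _ _

theorem integral_abs_cross_pow (k : ℕ) :
    ∫ x in stdTriangle, ∫ y in stdTriangle, ∫ z in stdTriangle, |cross x y z| ^ k =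
      6 * k.factorial / ((k + 2) * (k + 3)) * ∑ j ∈ Finset.range (k + 2),
        (j.factorial : ℝ) / (((k : ℝ) - j + 2) * (k + j + 3).factorial) := by
  set g : (ℝ × ℝ) × (ℝ × ℝ) → ℝ := fun w => ∫ z in stdTriangle, |cross z w.1 w.2| ^ k with hg_def
  have hg : Continuous g :=
    continuous_parametric_integral_of_continuous
      (f := fun (w : (ℝ × ℝ) × (ℝ × ℝ)) (z : ℝ × ℝ) => |cross z w.1 w.2| ^ k) (by fun_prop)
      isCompact_stdTriangle
  have hg0 (w) : 0 ≤ g w := integral_nonneg fun z => by positivity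
  have hgi : Integrable g ((volume.restrict stdTriangle).prod (volume.restrict stdTriangle)) := by
    rw [Measure.prod_restrict, ← Measure.volume_eq_prod]
    exact hg.continuousOn.integrableOn_compact (isCompact_stdTriangle.prod isCompact_stdTriangle)
  have hgo (w) : ENNReal.ofReal (g w) =
      ∫⁻ z in stdTriangle, ENNReal.ofReal (|cross z w.1 w.2| ^ k) :=
    ofReal_integral_eq_lintegral_ofReal
      (Continuous.continuousOn (by fun_prop) |>.integrableOn_compact isCompact_stdTriangle)
      (Eventually.of_forall fun z => by positivity)
  have hcyc (x y z : ℝ × ℝ) : cross x y z = cross z x y := by simp only [cross]; ring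
  have h1 : ∫ x in stdTriangle, ∫ y in stdTriangle, ∫ z in stdTriangle, |cross x y z| ^ k =
      ∫ w, g w ∂(volume.restrict stdTriangle).prod (volume.restrict stdTriangle) := by
    rw [integral_prod _ hgi]
    simp_rw [hg_def, ← hcyc]
  rw [h1, ← ENNReal.ofReal_eq_ofReal_iff (integral_nonneg hg0) ?_,
    ofReal_integral_eq_lintegral_ofReal hgi (Eventually.of_forall hg0),
    ← lintegral_cross_stdTriangle]
  · simp_rw [hgo]
  · refine mul_nonneg (by positivity) (Finset.sum_nonneg fun j hj => ?_)
    have hj' : (j : ℝ) ≤ k + 1 := by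
      exact_mod_cast Nat.lt_succ_iff.1 (Finset.mem_range.1 hj)
    exact div_nonneg (by positivity) (mul_nonneg (by linarith) (by positivity))

end RandomTriangle

/-- For every non-negative integer `k`, the k-th area moment of a random triangle in
a unit-area triangle equals `48·k!/((2+k)(3+k)) · Σ_{j=0}^{k+1} j!/((k-j+2)(k+j+3)!)`. -/
theorem stmt_2 (A B C : EuclideanSpace ℝ (Fin 2))
    (hT : volume (convexHull ℝ {A, B, C}) = 1) (k : ℕ) :
    (∫ x₀ in convexHull ℝ {A, B, C}, ∫ x₁ in convexHull ℝ {A, B, C},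
        ∫ x₂ in convexHull ℝ {A, B, C},
          (volume (convexHull ℝ {x₀, x₁, x₂})).toReal ^ k)
      = 48 * (Nat.factorial k : ℝ) / ((2 + (k:ℝ)) * (3 + (k:ℝ))) *
          ∑ j ∈ Finset.range (k + 2),
            (Nat.factorial j : ℝ) /
              (((k:ℝ) - (j:ℝ) + 2) * (Nat.factorial (k + j + 3) : ℝ)) := by
  open RandomTriangle in
  have hdet : |cross (coords A) (coords B) (coords C)| = 2 := by
    rw [volume_convexHull_triple, ENNReal.ofReal_eq_one] at hT
    linarith
  have hne : cross (coords A) (coords B) (coords C) ≠ 0 := by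
    rw [← abs_pos, hdet]
    norm_num
  simp_rw [setIntegral_convexHull_triple hne, volume_convexHull_triple,
    ContinuousLinearEquiv.apply_symm_apply, cross_add_edgeMap, abs_mul, hdet,
    mul_div_cancel_left₀ _ (two_ne_zero' ℝ), ENNReal.toReal_ofReal (abs_nonneg _)]
  simp_rw [integral_const_mul]
  rw [integral_abs_cross_pow, add_comm 2 (k : ℝ), add_comm 3 (k : ℝ)]
  ring
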